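/- arXiv:2111.14962 — 3 statements merged into one kernel-verified Lean document; each statement's English description precedes it below -/
import Mathlib

section
/- Let K be a field and let R = K[[T]] be the ring of formal power series over K. Let M = M₀ ⊕ M₁ be a ℤ/2-graded finitely generated free R-module and let d : M → M be an R-linear map with d(M₀) ⊆ M₁, d(M₁) ⊆ M₀ and d∘d = 0. Then there exist natural numbers m, k, a homogeneous R-basis x₁,…,x_m, y₁,…,y_m, z₁,…,z_k of M, and natural numbers n₁,…,n_m such that d(x_j) = T^{n_j}·y_j and d(y_j) = 0 for 1 ≤ j ≤ m, and d(z_j) = 0 for 1 ≤ j ≤ k. In other words, (M,d) is chain isomorphic to a direct sum of 1-step complexes (one generator, zero differential) and 2-step complexes whose differential is multiplication by T^{n_j}. -/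
open Module

/-- A basis of the kernel of `f` together with lifts of a basis of its range is a basis. -/
theorem LinearMap.exists_basis_sum_of_ker_of_range {R A N ι κ : Type*} [CommRing R]
    [AddCommGroup A] [Module R A] [AddCommGroup N] [Module R N] (f : A →ₗ[R] N)
    (bker : Basis ι R (LinearMap.ker f)) (brange : Basis κ R (LinearMap.range f))
    (x : κ → A) (hx : ∀ j, f (x j) = brange j) :
    ∃ B : Basis (ι ⊕ κ) R A,
      (∀ i, B (Sum.inl i) = bker i) ∧ ∀ j, B (Sum.inr j) = x j := by
  let s : LinearMap.range f →ₗ[R] A := brange.constr R x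
  have hsx : ∀ j, s (brange j) = x j := fun j => brange.constr_basis R x j
  have hfs : f.rangeRestrict ∘ₗ s = LinearMap.id := by
    refine brange.ext fun j => Subtype.ext ?_
    simp [hsx, hx]
  have hfs' : ∀ y, f (s y) = y := fun y =>
    congrArg Subtype.val (LinearMap.congr_fun hfs y)
  have hinj : Function.Injective s := fun a b hab =>
    Subtype.ext (by rw [← hfs' a, hab, hfs' b])
  have hcompl : IsCompl (LinearMap.ker f) (LinearMap.range s) := by
    constructor
    · rw [Submodule.disjoint_def]
      rintro _ hker ⟨y, rfl⟩
      have hy : y = 0 := Subtype.ext (by rw [← hfs' y]; exact hker)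
      rw [hy, map_zero]
    · rw [codisjoint_iff, eq_top_iff]
      intro a _
      refine Submodule.mem_sup.2 ⟨a - s (f.rangeRestrict a), ?_, s (f.rangeRestrict a),
        ⟨_, rfl⟩, sub_add_cancel _ _⟩
      simp [hfs']
  refine ⟨(bker.prod (brange.map (LinearEquiv.ofInjective s hinj))).map
    (Submodule.prodEquivOfIsCompl _ _ hcompl), fun i => ?_, fun j => ?_⟩
  · simp
  · simp [hsx]

/-- Smith normal form of the range of a linear map over a discrete valuation ring. -/
theorem LinearMap.exists_basis_range_eq_pow_smul {R A N : Type*} [CommRing R] [IsDomain R]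
    [IsDiscreteValuationRing R] [AddCommGroup A] [Module R A] [AddCommGroup N] [Module R N]
    [Module.Free R N] [Module.Finite R N] {ϖ : R} (hϖ : Irreducible ϖ) (f : A →ₗ[R] N) :
    ∃ (q p : ℕ) (w : Basis (Fin q ⊕ Fin p) R N) (b : Basis (Fin q) R (LinearMap.range f))
      (n : Fin q → ℕ), ∀ j, (b j : N) = ϖ ^ n j • w (Sum.inl j) := by
  classical
  obtain ⟨q, snf⟩ := (LinearMap.range f).smithNormalForm (Module.Free.chooseBasis R N)
  have ha : ∀ j, snf.a j ≠ 0 := fun j h => snf.bN.ne_zero j <| Subtype.ext <| by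
    rw [snf.snf, h, zero_smul, Submodule.coe_zero]
  choose n hn using fun j => IsDiscreteValuationRing.associated_pow_irreducible (ha j) hϖ
  choose u hu using hn
  let e : Fin q ⊕ Fin (Fintype.card ((Set.range snf.f)ᶜ : Set _)) ≃
      Module.Free.ChooseBasisIndex R N :=
    (Equiv.sumCongr (Equiv.ofInjective snf.f snf.f.injective)
      (Fintype.equivFin _).symm).trans (Equiv.Set.sumCompl (Set.range snf.f))
  refine ⟨q, _, snf.bM.reindex e.symm, snf.bN.unitsSMul u, n, fun j => ?_⟩
  have he : e (Sum.inl j) = snf.f j := by simp [e]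
  rw [Basis.unitsSMul_apply, Basis.reindex_apply, Equiv.symm_symm, he, ← hu j,
    Units.smul_def, Submodule.coe_smul, snf.snf, smul_smul, mul_comm]

/-- For consecutive maps `A → C → D` composing to zero, a basis of `ker g` adapted to the range
of `f`, such that lifts of the range extend every basis of `ker f` to a basis of `A`. -/
theorem LinearMap.exists_adapted_basis_ker {R A C D : Type*} [CommRing R] [IsDomain R]
    [IsDiscreteValuationRing R] [AddCommGroup A] [Module R A] [AddCommGroup C] [Module R C]
    [AddCommGroup D] [Module R D] [Module.Free R C] [Module.Finite R C] {ϖ : R}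
    (hϖ : Irreducible ϖ) (f : A →ₗ[R] C) (g : C →ₗ[R] D) (hgf : ∀ a, g (f a) = 0) :
    ∃ (q p : ℕ) (w : Basis (Fin q ⊕ Fin p) R (LinearMap.ker g)) (x : Fin q → A)
      (n : Fin q → ℕ), (∀ j, f (x j) = ϖ ^ n j • (w (Sum.inl j) : C)) ∧
      ∀ {ι : Type} (bker : Basis ι R (LinearMap.ker f)), ∃ B : Basis (ι ⊕ Fin q) R A,
        (∀ i, B (Sum.inl i) = bker i) ∧ ∀ j, B (Sum.inr j) = x j := by
  have hf : LinearMap.ker (f.codRestrict (LinearMap.ker g) hgf) = LinearMap.ker f :=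
    LinearMap.ker_codRestrict ..
  obtain ⟨q, p, w, b, n, hb⟩ :=
    LinearMap.exists_basis_range_eq_pow_smul hϖ (f.codRestrict (LinearMap.ker g) hgf)
  choose x hx using fun j => (b j).2
  refine ⟨q, p, w, x, n, fun j => congrArg Subtype.val ((hx j).trans (hb j)), fun bker => ?_⟩
  obtain ⟨B, hB, hBx⟩ := LinearMap.exists_basis_sum_of_ker_of_range _
    (bker.map (LinearEquiv.ofEq _ _ hf.symm)) b x hx
  exact ⟨B, fun i => by simpa using hB i, hBx⟩

/-- Regrouping of the index sets of the two homogeneous parts. -/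
def sumRegroup (q₀ q₁ p₀ p₁ : Type*) :
    ((q₁ ⊕ p₀) ⊕ q₀) ⊕ ((q₀ ⊕ p₁) ⊕ q₁) ≃ ((q₀ ⊕ q₁) ⊕ (q₀ ⊕ q₁)) ⊕ (p₀ ⊕ p₁) where
  toFun
    | .inl (.inl (.inl a)) => .inl (.inr (.inr a))
    | .inl (.inl (.inr a)) => .inr (.inl a)
    | .inl (.inr a) => .inl (.inl (.inl a))
    | .inr (.inl (.inl a)) => .inl (.inr (.inl a))
    | .inr (.inl (.inr a)) => .inr (.inr a)
    | .inr (.inr a) => .inl (.inl (.inr a))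
  invFun
    | .inl (.inr (.inr a)) => .inl (.inl (.inl a))
    | .inr (.inl a) => .inl (.inl (.inr a))
    | .inl (.inl (.inl a)) => .inl (.inr a)
    | .inl (.inr (.inl a)) => .inr (.inl (.inl a))
    | .inr (.inr a) => .inr (.inl (.inr a))
    | .inl (.inl (.inr a)) => .inr (.inr a)
  left_inv := by rintro (((_ | _) | _) | ((_ | _) | _)) <;> rfl
  right_inv := by rintro (((_ | _) | (_ | _)) | (_ | _)) <;> rfl


/-- Let `K` be a field, `R = K[[T]]`.  Let `M = M₀ ⊕ M₁` be a
`ℤ/2`-graded finitely generated free `R`-module and `d : M → M` an `R`-linear map with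
`d(M₀) ⊆ M₁`, `d(M₁) ⊆ M₀` and `d ∘ d = 0`.  Then there are `m, k : ℕ`, a homogeneous
`R`-basis `x₁,…,x_m, y₁,…,y_m, z₁,…,z_k` of `M`, and naturals `n₁,…,n_m`, with
`d xⱼ = T^{nⱼ} • yⱼ`, `d yⱼ = 0` and `d zⱼ = 0`. -/
theorem statement_4 (K : Type) [Field K] (M : Type) [AddCommGroup M]
    [Module (PowerSeries K) M] [Module.Finite (PowerSeries K) M]
    [Module.Free (PowerSeries K) M]
    (M₀ M₁ : Submodule (PowerSeries K) M) (hcompl : IsCompl M₀ M₁)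
    (d : M →ₗ[PowerSeries K] M)
    (hd01 : ∀ x ∈ M₀, d x ∈ M₁) (hd10 : ∀ x ∈ M₁, d x ∈ M₀)
    (hdd : d ∘ₗ d = 0) :
    ∃ (m k : ℕ) (x y : Fin m → M) (z : Fin k → M) (n : Fin m → ℕ)
      (B : Module.Basis ((Fin m ⊕ Fin m) ⊕ Fin k) (PowerSeries K) M),
      (∀ j, B (Sum.inl (Sum.inl j)) = x j) ∧
      (∀ j, B (Sum.inl (Sum.inr j)) = y j) ∧
      (∀ j, B (Sum.inr j) = z j) ∧
      (∀ j, x j ∈ M₀ ∨ x j ∈ M₁) ∧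
      (∀ j, y j ∈ M₀ ∨ y j ∈ M₁) ∧
      (∀ j, z j ∈ M₀ ∨ z j ∈ M₁) ∧
      (∀ j, d (x j) = (PowerSeries.X : PowerSeries K) ^ (n j) • y j) ∧
      (∀ j, d (y j) = 0) ∧
      (∀ j, d (z j) = 0) := by
  have hdd' : ∀ a, d (d a) = 0 := LinearMap.congr_fun hdd
  let f : M₀ →ₗ[PowerSeries K] M₁ := d.restrict hd01
  let g : M₁ →ₗ[PowerSeries K] M₀ := d.restrict hd10
  obtain ⟨q₀, p₁, w₁, x₀, n₀, hx₀, hB₀⟩ := LinearMap.exists_adapted_basis_ker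
    PowerSeries.X_irreducible f g fun a => Subtype.ext (hdd' a)
  obtain ⟨q₁, p₀, w₀, x₁, n₁, hx₁, hB₁⟩ := LinearMap.exists_adapted_basis_ker
    PowerSeries.X_irreducible g f fun a => Subtype.ext (hdd' a)
  obtain ⟨B₀, hBw₀, hBx₀⟩ := hB₀ w₀
  obtain ⟨B₁, hBw₁, hBx₁⟩ := hB₁ w₁
  have hw₀ : ∀ i, d (w₀ i : M₀) = 0 := fun i => congrArg Subtype.val (w₀ i).2
  have hw₁ : ∀ i, d (w₁ i : M₁) = 0 := fun i => congrArg Subtype.val (w₁ i).2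
  have hdx₀ : ∀ j, d (x₀ j) = (PowerSeries.X : PowerSeries K) ^ n₀ j • (w₁ (.inl j) : M) :=
    fun j => congrArg Subtype.val (hx₀ j)
  have hdx₁ : ∀ j, d (x₁ j) = (PowerSeries.X : PowerSeries K) ^ n₁ j • (w₀ (.inl j) : M) :=
    fun j => congrArg Subtype.val (hx₁ j)
  let e := (sumRegroup (Fin q₀) (Fin q₁) (Fin p₀) (Fin p₁)).trans
    (Equiv.sumCongr (Equiv.sumCongr finSumFinEquiv finSumFinEquiv) finSumFinEquiv)
  let B := ((B₀.prod B₁).map (Submodule.prodEquivOfIsCompl _ _ hcompl)).reindex e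
  refine ⟨q₀ + q₁, p₀ + p₁, fun j => B (.inl (.inl j)), fun j => B (.inl (.inr j)),
    fun j => B (.inr j), fun j => Sum.elim n₀ n₁ (finSumFinEquiv.symm j), B,
    fun _ => rfl, fun _ => rfl, fun _ => rfl, ?_, ?_, ?_, ?_, ?_, ?_⟩ <;>
  · intro j
    obtain ⟨j | j, rfl⟩ := finSumFinEquiv.surjective j <;>
    simp [B, e, sumRegroup, hBw₀, hBx₀, hBw₁, hBx₁, hw₀, hw₁, hdx₀, hdx₁]
end

section
/- Let K = 𝔽₂((V)) be the field of formal Laurent series over 𝔽₂ and let R = K[[U]]. Let δ : R → R be the 𝔽₂-linear map sending Σ_{i≥0, j∈ℤ} c_{i,j} U^i V^j to Σ_{i≥0, j∈ℤ} ((i+j) mod 2)·c_{i,j} U^i V^j (that is, δ = U∂_U + V∂_V, which is a derivation of R). Let M = M₀ ⊕ M₁ be a ℤ/2-graded finitely generated free R-module with a chosen homogeneous basis, and let d : M → M be an odd R-linear map with d∘d = 0, with matrix D in the chosen basis. Let A : M → M be the R-linear map whose matrix in the chosen basis is obtained by applying δ to each entry of D. Then A∘d + d∘A = 0, and there exists an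 R-linear map H : M → M such that A = d∘H + H∘d; that is, A is null-homotopic via an R-equivariant chain homotopy. -/
open PowerSeries

/-- The coefficient ring `R = 𝔽₂[𝒱,𝒱⁻¹]][[𝒰]]`: formal power series in `U` over the
field `K = 𝔽₂((V))` of formal Laurent series. -/
abbrev SurgeryRing : Type := PowerSeries (LaurentSeries (ZMod 2))

/-- The `𝔽₂`-linear map `δ = U∂_U + V∂_V` on `R`, sending
`Σ c_{i,j} U^i V^j` to `Σ ((i+j) mod 2) · c_{i,j} U^i V^j`. -/
noncomputable def deltaUV (f : SurgeryRing) : SurgeryRing :=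
  PowerSeries.mk fun i =>
    { coeff := fun j => ((i : ℤ) + j) • (PowerSeries.coeff i f).coeff j
      isPWO_support' := ((PowerSeries.coeff i f).isPWO_support').mono (by
        intro j hj
        simp only [Function.mem_support, ne_eq] at hj ⊢
        intro h0
        exact hj (by rw [h0, smul_zero])) }

section Connection

variable {R M : Type*} [CommRing R] [AddCommGroup M] [Module R M]

/-- An additive map satisfying the Leibniz rule, as a derivation over `ℤ`. -/
def derivationOfAddMonoidHom (δ : R →+ R) (h : ∀ a b, δ (a * b) = a * δ b + b * δ a) :
    Derivation ℤ R R :=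
  Derivation.mk' δ.toIntLinearMap h

/-- The additive map on a free module which applies a derivation to the coordinates
in a given basis. -/
noncomputable def Module.Basis.connection {ι : Type*} [Fintype ι] (b : Module.Basis ι R M)
    (δ : Derivation ℤ R R) : M →+ M where
  toFun m := ∑ i, δ (b.repr m i) • b i
  map_zero' := by simp
  map_add' x y := by simp [add_smul, Finset.sum_add_distrib]

theorem Module.Basis.connection_apply {ι : Type*} [Fintype ι] (b : Module.Basis ι R M)
    (δ : Derivation ℤ R R) (m : M) : b.connection δ m = ∑ i, δ (b.repr m i) • b i := rfl

theorem Module.Basis.connection_smul {ι : Type*} [Fintype ι] (b : Module.Basis ι R M)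
    (δ : Derivation ℤ R R) (r : R) (m : M) :
    b.connection δ (r • m) = δ r • m + r • b.connection δ m := by
  conv_rhs => enter [1, 2]; rw [← b.sum_repr m]
  simp only [connection_apply, map_smul, Finsupp.smul_apply, smul_eq_mul, Derivation.leibniz,
    add_smul, Finset.sum_add_distrib, Finset.smul_sum, smul_smul]
  rw [add_comm]
  simp only [mul_comm]

theorem Module.Basis.connection_self {ι : Type*} [Fintype ι] (b : Module.Basis ι R M)
    (δ : Derivation ℤ R R) (i : ι) : b.connection δ (b i) = 0 := by
  classical
  rw [connection_apply]
  refine Finset.sum_eq_zero fun j _ => ?_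
  rw [b.repr_self, Finsupp.single_apply]
  split_ifs <;> simp

/-- The map whose matrix is the entrywise derivative of the matrix of `d` is the commutator
of `d` with the coordinatewise connection. -/
theorem Module.Basis.toLin_map_derivation {ι : Type*} [Fintype ι] [DecidableEq ι]
    (b : Module.Basis ι R M) (δ : Derivation ℤ R R) (d : M →ₗ[R] M) (m : M) :
    Matrix.toLin b b ((LinearMap.toMatrix b b d).map δ) m =
      b.connection δ (d m) - d (b.connection δ m) := by
  have hlin : ∀ i, Matrix.toLin b b ((LinearMap.toMatrix b b d).map δ) (b i) =
      b.connection δ (d (b i)) := fun i => by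
    rw [Matrix.toLin_self, connection_apply]
    simp [LinearMap.toMatrix_apply]
  rw [← b.sum_repr m]
  simp only [map_sum, ← Finset.sum_sub_distrib]
  refine Finset.sum_congr rfl fun i _ => ?_
  rw [map_smul, map_smul, hlin, b.connection_smul, b.connection_smul, b.connection_self]
  simp

/-- If every principal ideal is stable under `δ`, every submodule of a finite free module over
a principal ideal domain is preserved by the coordinatewise connection of some basis. -/
theorem Submodule.exists_basis_connection_mem [IsDomain R] [IsPrincipalIdealRing R]
    {ι : Type*} [Fintype ι] (b : Module.Basis ι R M) (δ : Derivation ℤ R R)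
    (hδ : ∀ a, a ∣ δ a) (N : Submodule R M) :
    ∃ b' : Module.Basis ι R M, ∀ x ∈ N, b'.connection δ x ∈ N := by
  obtain ⟨n, S⟩ := N.smithNormalForm b
  refine ⟨S.bM, fun x hx => ?_⟩
  have hx' : x = ∑ i, S.bN.repr ⟨x, hx⟩ i • (S.bN i : M) := by
    have h := congrArg N.subtype (S.bN.sum_repr ⟨x, hx⟩)
    rw [map_sum] at h
    exact h.symm
  rw [hx', map_sum]
  refine N.sum_mem fun i _ => ?_
  rw [S.bM.connection_smul]
  refine N.add_mem (N.smul_mem _ (S.bN i).2) (N.smul_mem _ ?_)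
  obtain ⟨t, ht⟩ := hδ (S.a i)
  rw [S.snf, S.bM.connection_smul, S.bM.connection_self, ht, smul_zero, add_zero, mul_comm,
    mul_smul, ← S.snf]
  exact N.smul_mem _ (S.bN i).2

/-- Over a principal ideal domain whose ideals are stable under `δ`, a square-zero endomorphism
of a finite free module commutes with some `δ`-connection. -/
theorem exists_connection_commute [IsDomain R] [IsPrincipalIdealRing R]
    {ι : Type*} [Fintype ι] (b : Module.Basis ι R M) (δ : Derivation ℤ R R)
    (hδ : ∀ a, a ∣ δ a) (d : M →ₗ[R] M) (hdd : ∀ m, d (d m) = 0) :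
    ∃ c : M →+ M, (∀ (r : R) (m : M), c (r • m) = δ r • m + r • c m) ∧
      ∀ m, c (d m) = d (c m) := by
  obtain ⟨b', hb'⟩ := (LinearMap.range d).exists_basis_connection_mem b δ hδ
  have : Module.Free R M := .of_basis b
  have : Module.Finite R M := .of_basis b
  obtain ⟨s, hs⟩ := Module.projective_lifting_property d.rangeRestrict LinearMap.id
    d.surjective_rangeRestrict
  have hds : ∀ x, d (s x) = x := fun x => congrArg Subtype.val (LinearMap.congr_fun hs x)
  let e : M →+ LinearMap.range d :=
    { toFun := fun m => ⟨b'.connection δ (d m), hb' _ ⟨m, rfl⟩⟩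
      map_zero' := by ext; simp
      map_add' := fun x y => by ext; simp }
  have he : ∀ (r : R) (m : M), e (r • m) = δ r • d.rangeRestrict m + r • e m := fun r m => by
    ext; simp [e, b'.connection_smul]
  let p : M →ₗ[R] M := LinearMap.id - s ∘ₗ d.rangeRestrict
  have hdp : ∀ m, d (p m) = 0 := fun m => by simp [p, hds]
  have hp : ∀ m, d m = 0 → p m = m := fun m hm => by
    have : d.rangeRestrict m = 0 := Subtype.ext hm
    simp [p, this]
  refine ⟨(p.toAddMonoidHom.comp (b'.connection δ)).comp p.toAddMonoidHom +
    s.toAddMonoidHom.comp e, fun r m => ?_, fun m => ?_⟩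
  · have hsum : p m + s (d.rangeRestrict m) = m := by simp [p]
    simp only [AddMonoidHom.add_apply, AddMonoidHom.comp_apply, LinearMap.toAddMonoidHom_coe,
      map_smul, b'.connection_smul, map_add, he, smul_add]
    rw [hp (p m) (hdp m)]
    conv_rhs => rw [← hsum, smul_add]
    simp only [hsum]
    abel
  · have hed : e (d m) = 0 := by ext; simp [e, hdd]
    have hcd : d (b'.connection δ (d m)) = 0 := by
      obtain ⟨y, hy⟩ := hb' _ ⟨m, rfl⟩
      rw [← hy, hdd]
    simp only [AddMonoidHom.add_apply, AddMonoidHom.comp_apply, LinearMap.toAddMonoidHom_coe,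
      map_add, hed, map_zero, hdp, hds, add_zero, zero_add, hp _ (hdd m), hp _ hcd]
    rfl

end Connection

theorem coeff_coeff_deltaUV (f : SurgeryRing) (i : ℕ) (j : ℤ) :
    (PowerSeries.coeff i (deltaUV f)).coeff j =
      ((i : ℤ) + j) • (PowerSeries.coeff i f).coeff j := by
  simp [deltaUV]

theorem support_coeff_deltaUV_subset (f : SurgeryRing) (i : ℕ) :
    (PowerSeries.coeff i (deltaUV f)).support ⊆ (PowerSeries.coeff i f).support := by
  intro j hj h0
  exact hj (by rw [coeff_coeff_deltaUV, h0, smul_zero])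

theorem deltaUV_add (f g : SurgeryRing) : deltaUV (f + g) = deltaUV f + deltaUV g := by
  ext i j
  simp only [map_add, HahnSeries.coeff_add, coeff_coeff_deltaUV, smul_add]

theorem deltaUV_mul (f g : SurgeryRing) :
    deltaUV (f * g) = f * deltaUV g + g * deltaUV f := by
  rw [mul_comm g]
  ext n k
  rw [coeff_coeff_deltaUV, map_add, PowerSeries.coeff_mul, PowerSeries.coeff_mul,
    PowerSeries.coeff_mul, ← Finset.sum_add_distrib, HahnSeries.coeff_sum, HahnSeries.coeff_sum,
    Finset.smul_sum]
  refine Finset.sum_congr rfl fun p hp => ?_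
  rw [Finset.HasAntidiagonal.mem_antidiagonal] at hp
  rw [HahnSeries.coeff_add, HahnSeries.coeff_mul,
    HahnSeries.coeff_mul_right' (PowerSeries.coeff p.2 g).isPWO_support
      (support_coeff_deltaUV_subset g p.2),
    HahnSeries.coeff_mul_left' (PowerSeries.coeff p.1 f).isPWO_support
      (support_coeff_deltaUV_subset f p.1), ← Finset.sum_add_distrib, Finset.smul_sum]
  refine Finset.sum_congr rfl fun q hq => ?_
  rw [Finset.mem_antidiagonal] at hq
  rw [coeff_coeff_deltaUV, coeff_coeff_deltaUV, ← hp, ← hq.2.2]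
  simp only [zsmul_eq_mul]
  push_cast
  ring

/-- `deltaUV` as a derivation. -/
noncomputable def deltaUVDerivation :=
  derivationOfAddMonoidHom (AddMonoidHom.mk' deltaUV deltaUV_add) deltaUV_mul

theorem coe_deltaUVDerivation : ⇑deltaUVDerivation = deltaUV := rfl

theorem dvd_deltaUV (f : SurgeryRing) : f ∣ deltaUV f := by
  rcases eq_or_ne f 0 with rfl | hf
  · have h : deltaUV 0 = 0 := map_zero deltaUVDerivation
    rw [h]
  have hassoc : Associated f (PowerSeries.X ^ f.order.toNat) := by
    refine Associated.symm ⟨PowerSeries.Unit_of_divided_by_X_pow_order f, ?_⟩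
    rw [PowerSeries.Unit_of_divided_by_X_pow_order_nonzero hf,
      PowerSeries.X_pow_order_mul_divXPowOrder]
  refine hassoc.dvd.trans (PowerSeries.X_pow_dvd_iff.mpr fun m hm => ?_)
  ext j
  rw [coeff_coeff_deltaUV, PowerSeries.X_pow_dvd_iff.mp hassoc.symm.dvd m hm]
  simp

/-- Let `K = 𝔽₂((V))`, `R = K[[U]]` and let `δ = U∂_U + V∂_V`.  Let
`M = M₀ ⊕ M₁` be a `ℤ/2`-graded finitely generated free `R`-module with chosen
homogeneous basis (recorded by a parity function `g` on the index set), and let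
`d : M → M` be an odd `R`-linear map with `d ∘ d = 0` and matrix `D` in the chosen
basis.  Let `A` be the `R`-linear map whose matrix is obtained by applying `δ` to each
entry of `D`.  Then `A∘d + d∘A = 0` and `A` is null-homotopic via an `R`-equivariant
chain homotopy. -/
theorem statement_5 (ι : Type) [Fintype ι] [DecidableEq ι]
    (M : Type) [AddCommGroup M] [Module SurgeryRing M]
    (B : Module.Basis ι SurgeryRing M) (g : ι → ZMod 2)
    (d : M →ₗ[SurgeryRing] M)
    (hodd : ∀ i j, g i = g j → LinearMap.toMatrix B B d i j = 0)
    (hdd : d ∘ₗ d = 0) :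
    (Matrix.toLin B B ((LinearMap.toMatrix B B d).map deltaUV)) ∘ₗ d +
      d ∘ₗ (Matrix.toLin B B ((LinearMap.toMatrix B B d).map deltaUV)) = 0 ∧
    ∃ H : M →ₗ[SurgeryRing] M,
      Matrix.toLin B B ((LinearMap.toMatrix B B d).map deltaUV) =
        d ∘ₗ H + H ∘ₗ d := by
  have hdd' : ∀ m, d (d m) = 0 := LinearMap.congr_fun hdd
  have hA := B.toLin_map_derivation deltaUVDerivation d
  rw [coe_deltaUVDerivation] at hA
  refine ⟨LinearMap.ext fun m => ?_, ?_⟩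
  · simp [hA, hdd']
  · obtain ⟨c, hc, hcd⟩ := exists_connection_commute B deltaUVDerivation dvd_deltaUV d hdd'
    let H : M →ₗ[SurgeryRing] M :=
      { toFun := fun m => c m - B.connection deltaUVDerivation m
        map_add' := fun x y => by simp only [map_add]; abel
        map_smul' := fun r m => by
          simp only [hc, B.connection_smul, RingHom.id_apply, smul_sub]; abel }
    have hH : ∀ m, H m = c m - B.connection deltaUVDerivation m := fun _ => rfl
    have hneg : ∀ m : M, -m = m := fun m => by
      have : (-1 : SurgeryRing) = 1 := by
        rw [← map_one (algebraMap (ZMod 2) SurgeryRing), ← map_neg]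
        exact congrArg _ (by decide)
      rw [← neg_one_smul SurgeryRing m, this, one_smul]
    refine ⟨H, LinearMap.ext fun m => ?_⟩
    rw [hA, LinearMap.add_apply, LinearMap.comp_apply, LinearMap.comp_apply,
      ← hneg (H (d m)), hH, hH, hcd, map_sub]
    abel
end

section
/- Let R be a commutative ring of characteristic 2 equipped with a derivation δ : R → R (an additive map with δ(fg) = δ(f)g + fδ(g)). Let M be a finitely generated free R-module and d : M → M an R-linear map with d∘d = 0. For a basis B of M, let Φ_B : M → M be the R-linear map whose matrix in B is obtained by applying δ to each entry of the matrix of d in B. Then: (1) Φ_B∘d + d∘Φ_B = 0, i.e. Φ_B is a chain map; and (2) for any two bases B and B′ of M, there exists an R-linear map Q : M → M such that Φ_B + Φ_{B′} = d∘Q + Q∘d, i.e. the chain homotopy class of Φ_B is independent of the choice of basis. -/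
/-- Leibniz rule for applying a derivation to the entries of a product of matrices. -/
theorem Matrix.map_mul_derivation {R l m n : Type*} [CommRing R] [Fintype m]
    (δ : Derivation ℤ R R) (A : Matrix l m R) (B : Matrix m n R) :
    (A * B).map δ = A.map δ * B + A * B.map δ := by
  ext i j
  simp only [Matrix.map_apply, Matrix.add_apply, Matrix.mul_apply, map_sum, Derivation.leibniz,
    smul_eq_mul, ← Finset.sum_add_distrib]
  exact Finset.sum_congr rfl fun k _ => by ring

namespace LinearMap

variable {R M N P ι κ μ : Type*} [CommRing R] [AddCommGroup M] [Module R M]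
  [AddCommGroup N] [Module R N] [AddCommGroup P] [Module R P]
  [Fintype ι] [DecidableEq ι] [Fintype κ] [DecidableEq κ] [Fintype μ]

/-- The linear map whose matrix is obtained by applying `δ` to the matrix entries of `f`. -/
noncomputable def matrixDeriv (δ : Derivation ℤ R R) (b : Module.Basis ι R M)
    (c : Module.Basis κ R N) (f : M →ₗ[R] N) : M →ₗ[R] N :=
  Matrix.toLin b c ((toMatrix b c f).map δ)

theorem matrixDeriv_comp (δ : Derivation ℤ R R) (b : Module.Basis ι R M)
    (c : Module.Basis κ R N) (e : Module.Basis μ R P) (g : N →ₗ[R] P) (f : M →ₗ[R] N) :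
    matrixDeriv δ b e (g ∘ₗ f) = matrixDeriv δ c e g ∘ₗ f + g ∘ₗ matrixDeriv δ b c f := by
  simp only [matrixDeriv]
  rw [toMatrix_comp b c e, Matrix.map_mul_derivation, map_add, Matrix.toLin_mul b c e,
    Matrix.toLin_mul b c e, Matrix.toLin_toMatrix, Matrix.toLin_toMatrix]

theorem matrixDeriv_zero (δ : Derivation ℤ R R) (b : Module.Basis ι R M)
    (c : Module.Basis κ R N) : matrixDeriv δ b c 0 = 0 := by
  simpa using matrixDeriv_comp δ b c c 0 0

/-- Change of basis alters `matrixDeriv δ b b f` by a commutator with `f`. -/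
theorem matrixDeriv_change_basis (δ : Derivation ℤ R R) (b : Module.Basis ι R M)
    (c : Module.Basis κ R M) (f : M →ₗ[R] M) :
    matrixDeriv δ c c f =
      matrixDeriv δ b b f + matrixDeriv δ b c id ∘ₗ f - f ∘ₗ matrixDeriv δ b c id := by
  have h₁ := matrixDeriv_comp δ b b c id f
  have h₂ := matrixDeriv_comp δ b c c f id
  rw [id_comp, id_comp] at h₁
  rw [comp_id, comp_id] at h₂
  rw [eq_sub_iff_add_eq, ← h₂, h₁, add_comm]

end LinearMap

/-- Let `R` be a commutative ring of characteristic 2 with a derivation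
`δ : R → R`.  Let `M` be a finitely generated free `R`-module and `d : M → M` `R`-linear
with `d ∘ d = 0`.  For a basis `B` of `M`, let `Φ_B` be the `R`-linear map whose matrix
in `B` is obtained by applying `δ` entrywise to the matrix of `d` in `B`.  Then
(1) `Φ_B∘d + d∘Φ_B = 0`, and (2) for any two bases `B`, `B'` there is `Q` with
`Φ_B + Φ_{B'} = d∘Q + Q∘d`. -/
theorem statement_6 (R : Type) [CommRing R] [CharP R 2]
    (δ : R → R) (hadd : ∀ f g, δ (f + g) = δ f + δ g)
    (hleib : ∀ f g, δ (f * g) = δ f * g + f * δ g)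
    (M : Type) [AddCommGroup M] [Module R M]
    (ι ι' : Type) [Fintype ι] [DecidableEq ι] [Fintype ι'] [DecidableEq ι']
    (B : Module.Basis ι R M) (B' : Module.Basis ι' R M)
    (d : M →ₗ[R] M) (hdd : d ∘ₗ d = 0) :
    (Matrix.toLin B B ((LinearMap.toMatrix B B d).map δ)) ∘ₗ d +
      d ∘ₗ (Matrix.toLin B B ((LinearMap.toMatrix B B d).map δ)) = 0 ∧
    ∃ Q : M →ₗ[R] M,
      Matrix.toLin B B ((LinearMap.toMatrix B B d).map δ) +
        Matrix.toLin B' B' ((LinearMap.toMatrix B' B' d).map δ) =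
      d ∘ₗ Q + Q ∘ₗ d := by
  let D : Derivation ℤ R R := Derivation.mk' (AddMonoidHom.mk' δ hadd).toIntLinearMap
    fun f g => by
      change δ (f * g) = f * δ g + g * δ f
      rw [hleib]
      ring
  change LinearMap.matrixDeriv D B B d ∘ₗ d + d ∘ₗ LinearMap.matrixDeriv D B B d = 0 ∧
    ∃ Q : M →ₗ[R] M,
      LinearMap.matrixDeriv D B B d + LinearMap.matrixDeriv D B' B' d = d ∘ₗ Q + Q ∘ₗ d
  refine ⟨?_, LinearMap.matrixDeriv D B B' LinearMap.id, ?_⟩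
  · rw [← LinearMap.matrixDeriv_comp, hdd, LinearMap.matrixDeriv_zero]
  · have two_torsion (f : M →ₗ[R] M) : f + f = 0 := by
      rw [← two_smul R f, CharTwo.two_eq_zero, zero_smul]
    rw [LinearMap.matrixDeriv_change_basis D B B' d, ← add_sub_assoc, ← add_assoc, two_torsion,
      zero_add, sub_eq_add_neg, neg_eq_of_add_eq_zero_left (two_torsion _), add_comm]
end
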